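/- arXiv:1706.01774 — 2 statements merged into one kernel-verified Lean document; each statement's English description precedes it below -/
import Mathlib

section
/- Let (R, m) be a Henselian local ring and f = (f_1, ..., f_n) an n-tuple of polynomials in R[X_1, ..., X_n] with f(0) ∈ m^n and Jacobian determinant J(0) a unit in R. Then the map x ↦ f(x) is a homeomorphism of m^n onto itself in the m-adic topology. -/
open IsLocalRing MvPolynomial

lemma etale_lift_aux {R S : Type*} [CommRing R] [HenselianLocalRing R] [CommRing S] [Algebra R S]
    [Algebra.Etale R S] (φ : S →ₐ[R] ResidueField R) :
    ∃ ψ : S →ₐ[R] R, ∀ s, residue R (ψ s) = φ s := by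
  have hQ : (RingHom.ker φ).IsPrime := RingHom.ker_isPrime _
  obtain ⟨h, hh, hst⟩ := Algebra.IsEtaleAt.exists_isStandardEtale (R := R) (RingHom.ker φ)
  let P : StandardEtalePresentation R (Localization.Away h) := Nonempty.some inferInstance
  have hu : IsUnit (φ h) := isUnit_iff_ne_zero.mpr hh
  let φ' : Localization.Away h →ₐ[R] ResidueField R := IsLocalization.Away.liftAlgHom h (f := φ) hu
  have hP := P.hasMap.map φ'
  have H := ((HenselianLocalRing.TFAE R).out 0 1).mp ‹HenselianLocalRing R›
  obtain ⟨a, ha, ha'⟩ := H P.f P.monic_f (φ' P.x) hP.1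
    (hP.isUnit_derivative_f).ne_zero
  have hg : IsUnit (Polynomial.aeval a P.g) := by
    apply IsUnit.of_map (residue R)
    have h2 := hP.2
    rw [← ha'] at h2
    rw [← ResidueField.algebraMap_eq] at h2 ⊢
    rwa [Polynomial.aeval_algebraMap_apply] at h2
  have hm : P.HasMap a := ⟨by simpa [Polynomial.aeval_def, Polynomial.IsRoot] using ha, hg⟩
  let ψ' : Localization.Away h →ₐ[R] R := (P.lift a hm).comp P.equivRing.toAlgHom
  have e : (Algebra.ofId R (ResidueField R)).comp ψ' = φ' := by
    apply P.hom_ext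
    rw [← ha']
    simp [ψ', Algebra.ofId_apply]
  refine ⟨ψ'.comp (IsScalarTower.toAlgHom R S _), fun s => ?_⟩
  have := DFunLike.congr_fun e (algebraMap S _ s)
  simpa [φ', Algebra.ofId_apply] using this

lemma hensel_multi_aux {R : Type*} [CommRing R] [HenselianLocalRing R]
    {n : ℕ} (g : Fin n → MvPolynomial (Fin n) R)
    (hf0 : ∀ i, MvPolynomial.eval (0 : Fin n → R) (g i) ∈ maximalIdeal R)
    (hJ : IsUnit (Matrix.det (Matrix.of fun i j : Fin n =>
      MvPolynomial.eval (0 : Fin n → R) (MvPolynomial.pderiv j (g i))))) :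
    ∃ x : Fin n → R, (∀ i, x i ∈ maximalIdeal R) ∧ ∀ i, eval x (g i) = 0 := by
  let A := MvPolynomial (Fin n) R ⧸ (Ideal.span <| Set.range g)
  let P : Algebra.PreSubmersivePresentation R A (Fin n) (Fin n) :=
    { Algebra.Presentation.naive (v := g) with
      map := id
      map_inj := Function.injective_id }
  have key : ∀ p : MvPolynomial (Fin n) R, aeval (0 : Fin n → ResidueField R) p
      = residue R (eval 0 p) := by
    intro p
    have := MvPolynomial.aeval_algebraMap_apply (ResidueField R) (0 : Fin n → R) p
    rw [ResidueField.algebraMap_eq] at this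
    rw [MvPolynomial.aeval_eq_eval] at this
    rw [← this]
    congr 2
  let φ : A →ₐ[R] ResidueField R := Ideal.Quotient.liftₐ _ (aeval (0 : Fin n → ResidueField R))
    (by
      intro a ha
      have : Ideal.span (Set.range g) ≤ RingHom.ker (aeval (R := R) (0 : Fin n → ResidueField R)) := by
        rw [Ideal.span_le]
        rintro _ ⟨i, rfl⟩
        simp only [SetLike.mem_coe, RingHom.mem_ker]
        rw [key, residue_eq_zero_iff]
        exact hf0 i
      exact this ha)
  have hφ : ∀ p, φ (Ideal.Quotient.mk _ p) = aeval (0 : Fin n → ResidueField R) p := fun p => rfl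
  have hu : IsUnit (φ P.jacobian) := by
    have h1 : P.jacobian = Ideal.Quotient.mk _ P.jacobiMatrix.det := by
      rw [P.jacobian_eq_jacobiMatrix_det]; rfl
    rw [h1, hφ, key]
    apply IsUnit.map
    rw [RingHom.map_det, ← Matrix.det_transpose]
    convert hJ using 2
    ext i j
    simp only [Matrix.transpose_apply, RingHom.mapMatrix_apply, Matrix.map_apply, Matrix.of_apply,
      P.jacobiMatrix_apply]
    rfl
  let T := Localization.Away P.jacobian
  let Q := (Algebra.PreSubmersivePresentation.localizationAway T P.jacobian).comp P
  let Q' : Algebra.SubmersivePresentation R T (Unit ⊕ Fin n) (Unit ⊕ Fin n) :=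
    { Q with
      jacobian_isUnit := by
        change IsUnit Q.jacobian
        simp only [Q, Algebra.PreSubmersivePresentation.comp_jacobian_eq_jacobian_smul_jacobian,
          Algebra.PreSubmersivePresentation.localizationAway_jacobian, Algebra.smul_def]
        have := IsLocalization.Away.algebraMap_isUnit (S := T) P.jacobian
        exact this.mul this }
  have : Algebra.IsStandardSmoothOfRelativeDimension 0 R T :=
    Q'.isStandardSmoothOfRelativeDimension (by simp [Algebra.Presentation.dimension])
  have : Algebra.Etale R T := inferInstance
  let φ' : T →ₐ[R] ResidueField R := IsLocalization.Away.liftAlgHom P.jacobian (f := φ) hu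
  obtain ⟨ψ, hψ⟩ := etale_lift_aux φ'
  let χ : MvPolynomial (Fin n) R →ₐ[R] R :=
    (ψ.comp (IsScalarTower.toAlgHom R A T)).comp (Ideal.Quotient.mkₐ R _)
  have hχ : ∀ p, χ p = ψ (algebraMap A T (Ideal.Quotient.mk _ p)) := fun p => rfl
  have hχ' : ∀ p, χ p = eval (fun i => χ (X i)) p := by
    intro p
    have : χ = aeval (fun i => χ (X i)) := by ext; simp
    conv_lhs => rw [this]
    rw [MvPolynomial.aeval_eq_eval]
  refine ⟨fun i => χ (X i), fun i => ?_, fun i => ?_⟩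
  · change χ (X i) ∈ _
    rw [← residue_eq_zero_iff, hχ, hψ]
    have : φ' (algebraMap A T (Ideal.Quotient.mk _ (X i))) = φ (Ideal.Quotient.mk _ (X i)) := by
      simp [φ']
    rw [this, hφ]; simp
  · rw [← hχ', hχ, Ideal.Quotient.eq_zero_iff_mem.mpr (Ideal.subset_span (Set.mem_range_self i))]
    simp

lemma eval_sub_aux {R : Type*} [CommRing R] [IsLocalRing R] {n : ℕ} (x y : Fin n → R)
    (hx : ∀ i, x i ∈ maximalIdeal R) (hy : ∀ i, y i ∈ maximalIdeal R)
    (p : MvPolynomial (Fin n) R) :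
    ∃ c : Fin n → R, (∀ j, c j - eval 0 (pderiv j p) ∈ maximalIdeal R) ∧
      eval x p - eval y p = ∑ j, c j * (x j - y j) := by
  have h0 : ∀ p, eval y p - eval 0 p ∈ maximalIdeal R := by
    intro p
    induction p using MvPolynomial.induction_on with
    | C a => simp
    | add p q hp hq =>
      have := add_mem hp hq
      convert this using 1
      simp; ring
    | mul_X p i hp => simpa using Ideal.mul_mem_left _ _ (hy i)
  induction p using MvPolynomial.induction_on with
  | C a => exact ⟨0, by simp, by simp⟩
  | add p q hp hq =>
    obtain ⟨c, hc, hc'⟩ := hp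
    obtain ⟨d, hd, hd'⟩ := hq
    refine ⟨c + d, fun j => ?_, ?_⟩
    · convert add_mem (hc j) (hd j) using 1
      simp; ring
    · simp only [map_add, Pi.add_apply, add_mul, Finset.sum_add_distrib, ← hc', ← hd']
      ring
  | mul_X p i hp =>
    obtain ⟨c, hc, hc'⟩ := hp
    refine ⟨fun j => x i * c j + if j = i then eval y p else 0, fun j => ?_, ?_⟩
    · by_cases hj : j = i
      · subst hj
        simp only [if_true, Derivation.leibniz, pderiv_X_self, smul_eq_mul, map_add, map_mul, eval_X,
          Pi.zero_apply, map_one]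
        convert add_mem (Ideal.mul_mem_right (c j) _ (hx j)) (h0 p) using 1
        ring
      · simp only [if_neg hj, Derivation.leibniz, pderiv_X_of_ne (Ne.symm hj), smul_eq_mul, map_add,
          map_mul, eval_X, Pi.zero_apply, map_zero]
        convert (Ideal.mul_mem_right (c j) _ (hx i)) using 1
        ring
    · simp only [map_mul, eval_X, add_mul, Finset.sum_add_distrib, ite_mul, zero_mul,
        Finset.sum_ite_eq', Finset.sum_ite_eq, Finset.mem_univ, if_true, mul_assoc, ← Finset.mul_sum, ← hc']
      ring

lemma matrix_aux {R : Type*} [CommRing R] [IsLocalRing R]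
    {n : ℕ} (f : Fin n → MvPolynomial (Fin n) R)
    (hJ : IsUnit (Matrix.det (Matrix.of fun i j : Fin n =>
      MvPolynomial.eval (0 : Fin n → R) (MvPolynomial.pderiv j (f i)))))
    (x y : Fin n → R)
    (hx : ∀ i, x i ∈ maximalIdeal R) (hy : ∀ i, y i ∈ maximalIdeal R) :
    ∃ M N : Matrix (Fin n) (Fin n) R,
      (∀ i, eval x (f i) - eval y (f i) = ∑ j, M i j * (x j - y j)) ∧
      (∀ i, x i - y i = ∑ j, N i j * (eval x (f j) - eval y (f j))) := by
  choose c hc hc' using fun i => eval_sub_aux x y hx hy (f i)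
  let M : Matrix (Fin n) (Fin n) R := Matrix.of c
  have hM : IsUnit M.det := by
    apply IsUnit.of_map (residue R)
    have := hJ.map (residue R)
    rw [RingHom.map_det] at this ⊢
    convert this using 2
    ext i j
    simp only [RingHom.mapMatrix_apply, Matrix.map_apply, Matrix.of_apply, M]
    rw [← sub_eq_zero, ← map_sub, residue_eq_zero_iff]
    exact hc i j
  refine ⟨M, M⁻¹, hc', fun i => ?_⟩
  have h1 : (fun i => eval x (f i) - eval y (f i)) = M.mulVec (x - y) := by
    ext i; rw [hc']; rfl
  have h2 : M⁻¹.mulVec (fun i => eval x (f i) - eval y (f i)) = x - y := by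
    rw [h1, Matrix.mulVec_mulVec, Matrix.nonsing_inv_mul _ hM, Matrix.one_mulVec]
  exact (congrFun h2 i).symm

lemma continuous_aux {R : Type*} [CommRing R] [IsLocalRing R] {n : ℕ}
    (F : {x : Fin n → R // ∀ i, x i ∈ maximalIdeal R} →
          {x : Fin n → R // ∀ i, x i ∈ maximalIdeal R})
    (hF : ∀ x y, ∃ M : Matrix (Fin n) (Fin n) R,
      ∀ i, (F x).1 i - (F y).1 i = ∑ j, M i j * (x.1 j - y.1 j)) :
    letI : TopologicalSpace R := (maximalIdeal R).adicTopology
    Continuous F := by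
  letI : TopologicalSpace R := (maximalIdeal R).adicTopology
  rw [continuous_induced_rng]
  refine continuous_pi fun i => ?_
  rw [continuous_iff_continuousAt]
  intro x
  have hb := (maximalIdeal R).hasBasis_nhds_adic
  rw [ContinuousAt, (hb _).tendsto_right_iff]
  intro k _
  have h1 : ∀ᶠ y in nhds x, ∀ j, y.1 j - x.1 j ∈ maximalIdeal R ^ k := by
    rw [Filter.eventually_all]
    intro j
    have hc : Continuous fun y : {x : Fin n → R // ∀ i, x i ∈ maximalIdeal R} => y.1 j :=
      (continuous_apply j).comp continuous_subtype_val
    have := hc.continuousAt.eventually ((hb (x.1 j)).mem_of_mem (i := k) trivial)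
    filter_upwards [this] with y hy
    obtain ⟨z, hz, hz'⟩ := hy
    have hz' : x.1 j + z = y.1 j := hz'
    rw [← hz']; simpa using hz
  filter_upwards [h1] with y hy
  obtain ⟨M, hM⟩ := hF y x
  refine ⟨(F y).1 i - (F x).1 i, ?_, by simp⟩
  rw [hM]
  exact Ideal.sum_mem _ fun j _ => Ideal.mul_mem_left _ _ (hy j)

/-- Let `(R, m)` be a Henselian local ring and `f` an `n`-tuple of
polynomials in `R[X_1, ..., X_n]` with `f(0) ∈ m^n` and Jacobian determinant `J(0)` a unit
of `R`.  Then the polynomial map `x ↦ f(x)` is a homeomorphism of `m^n` onto itself with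
respect to the `m`-adic topology. -/
theorem henselian_polynomial_map_homeomorph_maximalIdeal_pow
    {R : Type*} [CommRing R] [HenselianLocalRing R]
    {n : ℕ} (f : Fin n → MvPolynomial (Fin n) R)
    (hf0 : ∀ i, MvPolynomial.eval (0 : Fin n → R) (f i) ∈ maximalIdeal R)
    (hJ : IsUnit (Matrix.det (Matrix.of fun i j : Fin n =>
      MvPolynomial.eval (0 : Fin n → R) (MvPolynomial.pderiv j (f i))))) :
    letI : TopologicalSpace R := (maximalIdeal R).adicTopology
    ∃ h : {x : Fin n → R // ∀ i, x i ∈ maximalIdeal R} ≃ₜ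
          {x : Fin n → R // ∀ i, x i ∈ maximalIdeal R},
      ∀ x, (h x : Fin n → R) = fun i => MvPolynomial.eval (x : Fin n → R) (f i) := by
  letI : TopologicalSpace R := (maximalIdeal R).adicTopology
  let F : {x : Fin n → R // ∀ i, x i ∈ maximalIdeal R} →
      {x : Fin n → R // ∀ i, x i ∈ maximalIdeal R} := fun x =>
    ⟨fun i => eval x.1 (f i), fun i => by
      obtain ⟨c, -, hc⟩ := eval_sub_aux x.1 0 x.2 (by simp) (f i)
      change eval x.1 (f i) ∈ _
      rw [← sub_add_cancel (eval x.1 (f i)) (eval 0 (f i)), hc]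
      refine add_mem (Ideal.sum_mem _ fun j _ => Ideal.mul_mem_left _ _ ?_) (hf0 i)
      simpa using x.2 j⟩
  have hinj : Function.Injective F := by
    intro x y hxy
    obtain ⟨M, N, -, hN⟩ := matrix_aux f hJ x.1 y.1 x.2 y.2
    ext i
    rw [← sub_eq_zero, hN]
    refine Finset.sum_eq_zero fun j _ => ?_
    have : eval x.1 (f j) = eval y.1 (f j) := congrFun (congrArg Subtype.val hxy) j
    rw [this]; simp
  have hsurj : Function.Surjective F := by
    intro y
    obtain ⟨x, hx, hx'⟩ := hensel_multi_aux (fun i => f i - C (y.1 i))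
      (fun i => by simpa using sub_mem (hf0 i) (y.2 i)) (by simpa using hJ)
    refine ⟨⟨x, hx⟩, ?_⟩
    ext i
    have := hx' i
    simpa [sub_eq_zero] using this
  let e := Equiv.ofBijective F ⟨hinj, hsurj⟩
  refine ⟨⟨e, ?_, ?_⟩, fun x => rfl⟩
  · apply continuous_aux
    intro x y
    obtain ⟨M, N, hM, -⟩ := matrix_aux f hJ x.1 y.1 x.2 y.2
    exact ⟨M, hM⟩
  · apply continuous_aux
    intro x y
    obtain ⟨x, rfl⟩ := e.surjective x
    obtain ⟨y, rfl⟩ := e.surjective y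
    obtain ⟨M, N, -, hN⟩ := matrix_aux f hJ x.1 y.1 x.2 y.2
    refine ⟨N, ?_⟩
    simp only [Equiv.invFun_as_coe, Equiv.symm_apply_apply]
    exact hN
end

section
/- Every Henselian non-trivially valued field K of equicharacteristic zero satisfies the density property: if X is a smooth irreducible K-variety and U ⊆ X is a nonempty Zariski open subset, then U(K) is dense in X(K) with respect to the valuation topology. -/
open MvPolynomial
section DensityAux
variable {K : Type*} {Γ₀ : Type*} [Field K] [LinearOrderedCommGroupWithZero Γ₀] [Valued K Γ₀]

/-- Hensel's lemma for `1 + y + (small higher order terms)`. -/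
lemma density_hensel_sum [HenselianLocalRing ↥((Valued.v : Valuation K Γ₀).valuationSubring)]
    (n : ℕ) (e : ℕ → K) (he : ∀ i < n, Valued.v (e i) < 1) :
    ∃ y : K, Valued.v y ≤ 1 ∧ 1 + y + ∑ i ∈ Finset.range n, e i * y ^ (i + 2) = 0 := by
  classical
  let O := (Valued.v : Valuation K Γ₀).valuationSubring
  have hmem : ∀ x : O, x ∈ IsLocalRing.maximalIdeal O ↔ Valued.v (x : K) < 1 := by
    intro x
    exact Valuation.mem_maximalIdeal_iff ..
  let d : ℕ → O := fun i => if h : i < n then ⟨e i, (he i h).le⟩ else 0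
  have hd : ∀ i, d i ∈ IsLocalRing.maximalIdeal O := by
    intro i
    rw [hmem]
    by_cases h : i < n
    · simpa [d, h] using he i h
    · simp [d, h]
  have hde : ∀ i < n, ((d i : O) : K) = e i := by
    intro i h
    simp [d, h]
  let S : Polynomial O := ∑ i ∈ Finset.range n, Polynomial.C (d i) * Polynomial.X ^ (n - 1 - i)
  let F : Polynomial O := Polynomial.X ^ (n + 1) + (Polynomial.X ^ n + S)
  have hSdeg : S.degree < (n + 1 : ℕ) := by
    refine lt_of_le_of_lt (Polynomial.degree_sum_le _ _) ?_
    rw [Finset.sup_lt_iff (by exact WithBot.bot_lt_coe _)]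
    intro i _
    refine lt_of_le_of_lt (Polynomial.degree_C_mul_X_pow_le _ _) ?_
    exact_mod_cast (by omega)
  have hF : F.Monic := by
    apply Polynomial.monic_X_pow_add
    refine lt_of_le_of_lt (Polynomial.degree_add_le _ _) (max_lt ?_ hSdeg)
    refine lt_of_le_of_lt (Polynomial.degree_X_pow_le _) ?_
    exact_mod_cast (by omega)
  have hSe : S.eval (-1) ∈ IsLocalRing.maximalIdeal O := by
    simp only [S, Polynomial.eval_finsetSum]
    refine Ideal.sum_mem _ fun i _ => ?_
    simp only [Polynomial.eval_mul, Polynomial.eval_C]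
    exact Ideal.mul_mem_right _ _ (hd i)
  have hSd : S.derivative.eval (-1) ∈ IsLocalRing.maximalIdeal O := by
    simp only [S, Polynomial.derivative_sum, Polynomial.eval_finsetSum]
    refine Ideal.sum_mem _ fun i _ => ?_
    simp only [Polynomial.derivative_C_mul, Polynomial.eval_mul, Polynomial.eval_C]
    exact Ideal.mul_mem_right _ _ (hd i)
  have hF0 : F.eval (-1) ∈ IsLocalRing.maximalIdeal O := by
    have : F.eval (-1) = S.eval (-1) := by
      simp only [F, Polynomial.eval_add, Polynomial.eval_pow, Polynomial.eval_X]
      ring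
    rwa [this]
  have hF1 : IsUnit (F.derivative.eval (-1)) := by
    have h1 : F.derivative.eval (-1) = (-1) ^ n + S.derivative.eval (-1) := by
      simp only [F, Polynomial.derivative_add, Polynomial.eval_add, Polynomial.derivative_X_pow,
        Polynomial.eval_mul, Polynomial.eval_pow, Polynomial.eval_X, Polynomial.eval_C]
      rcases n with _ | n
      · simp
      · simp
        ring
    have h2 : IsUnit ((-1 : O) ^ n) := (isUnit_one.neg).pow n
    by_contra hcon
    have h3 : F.derivative.eval (-1) ∈ IsLocalRing.maximalIdeal O := hcon
    rw [h1] at h3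
    have h4 := (Ideal.add_mem_iff_left _ hSd).1 h3
    exact h4 h2
  obtain ⟨a, ha, ha'⟩ := HenselianLocalRing.is_henselian F hF (-1) hF0 hF1
  have hau : IsUnit a := by
    by_contra hcon
    have h3 : a ∈ IsLocalRing.maximalIdeal O := hcon
    have h4 := Ideal.sub_mem _ h3 ha'
    rw [sub_sub_cancel] at h4
    exact h4 (isUnit_one.neg)
  obtain ⟨u, rfl⟩ := hau
  refine ⟨((u⁻¹ : Oˣ) : O), ((u⁻¹ : Oˣ) : O).2, ?_⟩
  have key : (1 : O) + (u⁻¹ : Oˣ) + ∑ i ∈ Finset.range n, d i * ((u⁻¹ : Oˣ) : O) ^ (i + 2) = 0 := by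
    have h0 : ((u⁻¹ : Oˣ) : O) ^ (n + 1) * F.eval (u : O) = 0 := by
      rw [Polynomial.IsRoot.def.1 ha, mul_zero]
    have hu : ((u⁻¹ : Oˣ) : O) * (u : O) = 1 := u.inv_mul
    rw [← h0]
    simp only [F, S, Polynomial.eval_add, Polynomial.eval_pow, Polynomial.eval_X,
      Polynomial.eval_finsetSum, Polynomial.eval_mul, Polynomial.eval_C, mul_add, Finset.mul_sum]
    rw [← add_assoc]
    congr 1
    · congr 1
      · rw [← mul_pow, hu, one_pow]
      · rw [pow_succ', mul_assoc, ← mul_pow, hu, one_pow, mul_one]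
    · refine Finset.sum_congr rfl fun i hi => ?_
      have hi' := Finset.mem_range.1 hi
      have : n + 1 = (i + 2) + (n - 1 - i) := by omega
      rw [this, pow_add _ (i + 2), mul_left_comm, mul_assoc, ← mul_pow, hu, one_pow, mul_one]
  have key' := congrArg (algebraMap O K) key
  simp only [map_add, map_one, map_sum, map_mul, map_pow, map_zero] at key'
  rw [← key']
  congr 1
  refine Finset.sum_congr rfl fun i hi => ?_
  rw [← hde i (Finset.mem_range.1 hi)]
  rfl

lemma density_small (s : Set K) (hs : s ∈ nhds (0 : K)) :
    ∃ s' ∈ nhds (0 : K), ∀ x ∈ s', ∀ y, Valued.v y ≤ 1 → x * y ∈ s := by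
  obtain ⟨γ, hγ⟩ := Valued.mem_nhds_zero.1 hs
  refine ⟨_, Valued.mem_nhds_zero.2 ⟨γ, subset_rfl⟩, fun x hx y hy => hγ ?_⟩
  simp only [Set.mem_ofPred_eq] at hx ⊢
  rw [map_mul]
  refine lt_of_le_of_lt (mul_le_of_le_one_right' ?_) hx
  exact (Valuation.restrict_le_one_iff _).2 hy

lemma density_neBot (hnontriv : ∃ x : K, Valued.v x ≠ 0 ∧ Valued.v x ≠ 1) :
    (nhdsWithin (0 : K) {0}ᶜ).NeBot := by
  obtain ⟨π, hπ0, hπ1⟩ : ∃ x : K, Valued.v x ≠ 0 ∧ Valued.v x < 1 := by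
    obtain ⟨x, h0, h1⟩ := hnontriv
    rcases lt_or_gt_of_ne h1 with h | h
    · exact ⟨x, h0, h⟩
    · refine ⟨x⁻¹, by simpa using h0, ?_⟩
      rw [map_inv₀]
      exact inv_lt_one_of_one_lt₀ h
  rw [← mem_closure_iff_nhdsWithin_neBot, mem_closure_iff_nhds]
  intro t ht
  obtain ⟨γ, hγ⟩ := Valued.mem_nhds_zero.1 ht
  obtain ⟨c, hc⟩ := MonoidWithZeroHom.ValueGroup₀.restrict₀_surjective
    (.ofClass (Valued.v : Valuation K Γ₀)) γ.1
  have hc' : Valued.v.restrict c = γ.1 := hc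
  have hc0 : c ≠ 0 := by
    rintro rfl
    rw [map_zero] at hc'
    exact γ.ne_zero hc'.symm
  have hp0 : π ≠ 0 := fun h => hπ0 (by simp [h])
  refine ⟨c * π, hγ ?_, mul_ne_zero hc0 hp0⟩
  simp only [Set.mem_ofPred_eq]
  rw [← hc', Valuation.restrict_lt_iff, map_mul]
  exact mul_lt_of_lt_one_right (by simpa [zero_lt_iff] using hc0) hπ1

lemma density_infinite (hnontriv : ∃ x : K, Valued.v x ≠ 0 ∧ Valued.v x ≠ 1)
    (x : K) (s : Set K) (hs : s ∈ nhds x) : s.Infinite := by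
  have := density_neBot hnontriv
  have h0 : (fun h : K => x + h) ⁻¹' s ∈ nhds (0 : K) := by
    apply ContinuousAt.preimage_mem_nhds (by fun_prop)
    simpa using hs
  have h1 := infinite_of_mem_nhds (0 : K) h0
  refine Set.Infinite.mono ?_ (h1.image (add_right_injective x).injOn)
  rintro _ ⟨y, hy, rfl⟩
  exact hy

lemma density_exists_ne_zero (hnontriv : ∃ x : K, Valued.v x ≠ 0 ∧ Valued.v x ≠ 1)
    {n : ℕ} (t₀ : Fin n → K) (s : Set (Fin n → K)) (hs : s ∈ nhds t₀)
    (p : MvPolynomial (Fin n) K) (hp : p ≠ 0) : ∃ t ∈ s, eval t p ≠ 0 := by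
  rw [nhds_pi, Filter.mem_pi'] at hs
  obtain ⟨J, u, hu, hus⟩ := hs
  by_contra! hcon
  apply hp
  refine MvPolynomial.funext_set u (fun i => density_infinite hnontriv _ _ (hu i)) fun x hx => ?_
  rw [map_zero]
  exact hcon x (hus fun i _ => hx i trivial)

lemma density_continuous_eval₂ {n : ℕ} (q : Polynomial (MvPolynomial (Fin n) K)) :
    Continuous fun a : (Fin n → K) × K => q.eval₂ (eval a.1) a.2 := by
  simp only [Polynomial.eval₂_eq_sum_range]
  refine continuous_finsetSum _ fun i _ => ?_
  exact ((MvPolynomial.continuous_eval _).comp continuous_fst).mul (continuous_snd.pow i)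

/-- Continuity of simple roots over a Henselian field. -/
lemma density_root [HenselianLocalRing ↥((Valued.v : Valuation K Γ₀).valuationSubring)]
    {n : ℕ} (q : Polynomial (MvPolynomial (Fin n) K)) (t₀ : Fin n → K) (z₀ : K)
    (h0 : q.eval₂ (eval t₀) z₀ = 0) (h1 : q.derivative.eval₂ (eval t₀) z₀ ≠ 0)
    (W : Set ((Fin n → K) × K)) (hW : W ∈ nhds (t₀, z₀)) :
    ∀ᶠ t in nhds t₀, ∃ z, (t, z) ∈ W ∧ q.eval₂ (eval t) z = 0 := by
  let Q := Polynomial.taylor (C z₀) q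
  let c : ℕ → (Fin n → K) → K := fun i t => eval t (Q.coeff i)
  have hc : ∀ i, Continuous (c i) := fun i => MvPolynomial.continuous_eval _
  have hev : ∀ (r : Polynomial (MvPolynomial (Fin n) K)) (t : Fin n → K),
      eval t (r.eval (C z₀)) = r.eval₂ (eval t) z₀ := by
    intro r t
    rw [Polynomial.eval, Polynomial.hom_eval₂]
    simp
  have hc0 : c 0 t₀ = 0 := by
    simp only [c, Q, Polynomial.taylor_coeff_zero, hev, h0]
  have hc1 : c 1 t₀ ≠ 0 := by
    simpa only [c, Q, Polynomial.taylor_coeff_one, hev] using h1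
  have hQ : ∀ t w, Q.eval₂ (eval t) w = q.eval₂ (eval t) (w + z₀) := by
    intro t w
    simp only [Q, Polynomial.taylor_apply, Polynomial.eval₂_comp]
    simp
  let m := Q.natDegree
  have hsum : ∀ t w, Q.eval₂ (eval t) w =
      c 0 t + c 1 t * w + ∑ i ∈ Finset.range m, c (i + 2) t * w ^ (i + 2) := by
    intro t w
    rw [Polynomial.eval₂_eq_sum_range' (eval t) (n := m + 2) (by omega)]
    rw [Finset.sum_range_succ', Finset.sum_range_succ']
    simp only [c]
    ring
  have hratio : Filter.Tendsto (fun t => c 0 t / c 1 t) (nhds t₀) (nhds 0) := by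
    have := ((hc 0).continuousAt (x := t₀)).div ((hc 1).continuousAt) hc1
    rw [ContinuousAt, Pi.div_apply, hc0, zero_div] at this
    exact this
  have hone : {x : K | Valued.v x < 1} ∈ nhds (0 : K) := by
    refine Valued.mem_nhds_zero.2 ⟨1, fun x hx => ?_⟩
    exact (Valuation.restrict_lt_one_iff _).1 hx
  have hsmall : ∀ i, ∀ᶠ t in nhds t₀,
      Valued.v (c (i + 2) t * (c 0 t / c 1 t) ^ (i + 1) / c 1 t) < 1 := by
    intro i
    have h2 : Filter.Tendsto (fun t => c (i + 2) t * (c 0 t / c 1 t) ^ (i + 1) / c 1 t)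
        (nhds t₀) (nhds 0) := by
      have := (((hc (i + 2)).tendsto t₀).mul (hratio.pow (i + 1))).div ((hc 1).tendsto t₀) hc1
      rw [zero_pow (Nat.succ_ne_zero i), mul_zero, zero_div] at this
      exact this
    exact h2 hone
  have hall : ∀ᶠ t in nhds t₀, ∀ i ∈ Finset.range m,
      Valued.v (c (i + 2) t * (c 0 t / c 1 t) ^ (i + 1) / c 1 t) < 1 :=
    (Filter.eventually_all_finset _).2 fun i _ => hsmall i
  have hc1' : ∀ᶠ t in nhds t₀, c 1 t ≠ 0 := (hc 1).continuousAt.eventually_ne hc1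
  obtain ⟨A, hA, B, hB, hAB⟩ := mem_nhds_prod_iff.1 hW
  have hB' : (fun h : K => h + z₀) ⁻¹' B ∈ nhds (0 : K) := by
    apply ContinuousAt.preimage_mem_nhds (by fun_prop)
    simpa using hB
  obtain ⟨B₁, hB₁, hBB⟩ := density_small _ hB'
  filter_upwards [hall, hc1', hA, hratio hB₁] with t ht ht1 htA htB
  obtain ⟨y, hy, hy0⟩ := density_hensel_sum m
    (fun i => c (i + 2) t * (c 0 t / c 1 t) ^ (i + 1) / c 1 t)
    (fun i hi => ht i (Finset.mem_range.2 hi))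
  refine ⟨c 0 t / c 1 t * y + z₀, hAB ⟨htA, hBB _ htB y hy⟩, ?_⟩
  rw [← hQ, hsum]
  have : c 0 t * (1 + y + ∑ i ∈ Finset.range m,
      c (i + 2) t * (c 0 t / c 1 t) ^ (i + 1) / c 1 t * y ^ (i + 2)) = 0 := by
    rw [hy0, mul_zero]
  rw [← this, mul_add, mul_add, Finset.mul_sum]
  congr 1
  · field_simp
  · refine Finset.sum_congr rfl fun i _ => ?_
    rw [mul_pow, pow_succ (c 0 t / c 1 t) (i + 1)]
    ring

lemma density_exists_hom {n : ℕ} {B : Type*} [CommRing B] [Algebra (MvPolynomial (Fin n) K) B]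
    (P : StandardEtalePresentation (MvPolynomial (Fin n) K) B) (t : Fin n → K) (z : K)
    (h1 : P.f.eval₂ (eval t) z = 0) (h2 : P.g.eval₂ (eval t) z ≠ 0) :
    ∃ φ : B →+* K, (∀ r, φ (algebraMap _ B r) = eval t r) ∧ φ P.x = z := by
  let : Algebra (MvPolynomial (Fin n) K) K := (eval t).toAlgebra
  have hm : P.P.HasMap z := ⟨h1, IsUnit.mk0 _ h2⟩
  refine ⟨((P.P.lift z hm).comp P.equivRing.toAlgHom).toRingHom, fun r => ?_, ?_⟩
  · exact AlgHom.commutes ((P.P.lift z hm).comp P.equivRing.toAlgHom) r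
  · simp

/-- The density statement on a standard etale chart. -/
lemma density_chart [HenselianLocalRing ↥((Valued.v : Valuation K Γ₀).valuationSubring)]
    (hnontriv : ∃ x : K, Valued.v x ≠ 0 ∧ Valued.v x ≠ 1)
    {n : ℕ} {B : Type*} [CommRing B] [IsDomain B] [Algebra K B]
    [Algebra (MvPolynomial (Fin n) K) B] [IsScalarTower K (MvPolynomial (Fin n) K) B]
    (P : StandardEtalePresentation (MvPolynomial (Fin n) K) B)
    (φ₀ : B →ₐ[K] K) (b : B) (hb : b ≠ 0) {N : ℕ} (x : Fin N → B)
    (s : Set (Fin N → K)) (hs : s ∈ nhds (fun i => φ₀ (x i))) :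
    ∃ φ : B →ₐ[K] K, (fun i => φ (x i)) ∈ s ∧ φ b ≠ 0 := by
  let R := MvPolynomial (Fin n) K
  let t₀ : Fin n → K := fun i => φ₀ (algebraMap R B (X i))
  let z₀ : K := φ₀ P.x
  have hφ₀ : ∀ r : R, φ₀ (algebraMap R B r) = eval t₀ r := by
    intro r
    have : (φ₀.comp (IsScalarTower.toAlgHom K R B)) = MvPolynomial.aeval t₀ := by
      apply MvPolynomial.algHom_ext
      intro i
      rw [MvPolynomial.aeval_X]
      rfl
    have h := DFunLike.congr_fun this r
    rw [MvPolynomial.aeval_eq_eval] at h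
    exact h
  have hpoly : ∀ (φ : B →+* K) (t : Fin n → K) (_ : ∀ r : R, φ (algebraMap R B r) = eval t r)
      (q : Polynomial R), φ (Polynomial.aeval P.x q) = q.eval₂ (eval t) (φ P.x) := by
    intro φ t h q
    rw [Polynomial.aeval_def, Polynomial.hom_eval₂]
    congr 1
    exact RingHom.ext h
  have hpoly₀ := hpoly φ₀.toRingHom t₀ hφ₀
  have hf0 : P.f.eval₂ (eval t₀) z₀ = 0 := by
    have := hpoly₀ P.f
    rw [P.hasMap.1, map_zero] at this
    exact this.symm
  have hf1 : P.f.derivative.eval₂ (eval t₀) z₀ ≠ 0 := by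
    have := (P.hasMap.isUnit_derivative_f.map φ₀.toRingHom).ne_zero
    rwa [hpoly₀] at this
  have hg0 : P.g.eval₂ (eval t₀) z₀ ≠ 0 := by
    have := (P.hasMap.2.map φ₀.toRingHom).ne_zero
    rwa [hpoly₀] at this
  choose p k hpk using P.exists_mul_aeval_x_g_pow_eq_aeval_x
  have hval : ∀ (φ : B →+* K) (t : Fin n → K) (_ : ∀ r : R, φ (algebraMap R B r) = eval t r)
      (_ : P.g.eval₂ (eval t) (φ P.x) ≠ 0) (y : B),
      φ y = (p y).eval₂ (eval t) (φ P.x) / (P.g.eval₂ (eval t) (φ P.x)) ^ (k y) := by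
    intro φ t h hg y
    rw [eq_div_iff (pow_ne_zero _ hg), ← hpoly φ t h, ← hpoly φ t h, ← map_pow, ← map_mul, hpk]
  let Φ : (Fin n → K) × K → (Fin N → K) := fun a i =>
    (p (x i)).eval₂ (eval a.1) a.2 / (P.g.eval₂ (eval a.1) a.2) ^ (k (x i))
  have hΦ : ContinuousAt Φ (t₀, z₀) := by
    refine continuousAt_pi.2 fun i => ?_
    exact (density_continuous_eval₂ _).continuousAt.div
      ((density_continuous_eval₂ _).pow _).continuousAt (pow_ne_zero _ hg0)
  have hΦ0 : Φ (t₀, z₀) = fun i => φ₀ (x i) := by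
    funext i
    exact (hval φ₀.toRingHom t₀ hφ₀ hg0 (x i)).symm
  have hW1 : Φ ⁻¹' s ∈ nhds (t₀, z₀) := hΦ.preimage_mem_nhds (by rwa [hΦ0])
  have hW2 : {a : (Fin n → K) × K | P.g.eval₂ (eval a.1) a.2 ≠ 0} ∈ nhds (t₀, z₀) :=
    (density_continuous_eval₂ P.g).continuousAt.eventually_ne hg0
  -- a nonzero polynomial in the coordinates divisible by `b`
  obtain ⟨r, hr0, hr⟩ : ∃ r : R, r ≠ 0 ∧ b ∣ algebraMap R B r := by
    have hint : IsIntegral R P.x := ⟨P.f, P.monic_f, P.hasMap.1⟩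
    have h1 : IsIntegral R (Polynomial.aeval P.x (p b)) := by
      rw [Polynomial.aeval_def, Polynomial.eval₂_eq_sum_range]
      exact IsIntegral.sum _ fun i _ => isIntegral_algebraMap.mul (hint.pow i)
    have h2 : Polynomial.aeval P.x (p b) ≠ 0 := by
      rw [← hpk]
      exact mul_ne_zero hb (pow_ne_zero _ P.hasMap.2.ne_zero)
    obtain ⟨r, hr0, hr⟩ := h1.isAlgebraic.exists_nonzero_dvd (mem_nonZeroDivisors_of_ne_zero h2)
    exact ⟨r, hr0, (Dvd.intro _ (hpk b)).trans hr⟩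
  obtain ⟨t, ⟨z, ⟨hz1, hz2⟩, hz3⟩, htr⟩ := density_exists_ne_zero hnontriv t₀ _
    (density_root P.f t₀ z₀ hf0 hf1 _ (Filter.inter_mem hW1 hW2)) r hr0
  obtain ⟨φ, hφ, hφx⟩ := density_exists_hom P t z hz3 hz2
  have hφK : ∀ c : K, φ (algebraMap K B c) = c := by
    intro c
    rw [IsScalarTower.algebraMap_apply K R B, hφ]
    simp [R]
  refine ⟨{ φ with commutes' := hφK }, ?_, ?_⟩
  · have : (fun i => φ (x i)) = Φ (t, z) := by
      funext i
      rw [hval φ t hφ (by rw [hφx]; exact hz2), hφx]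
    change (fun i => φ (x i)) ∈ s
    rw [this]
    exact hz1
  · change φ b ≠ 0
    intro h
    apply htr
    obtain ⟨w, hw⟩ := hr
    rw [← hφ, hw, map_mul, h, zero_mul]

end DensityAux

/-- density property.  Every Henselian non-trivially valued field `K` of
equicharacteristic zero satisfies the density property: if `X` is a smooth irreducible
`K`-variety (presented here in an affine chart as the zero locus `V(I) ⊆ K^N` of a prime
ideal `I` with `K[X_1,...,X_N]/I` smooth over `K`) and `U ⊆ X` is a nonempty Zariski open
subset (it suffices to consider a basic open subset `D(f)` with `f ∉ I`, which is nonempty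
since `I` is prime), then `U(K)` is dense in `X(K)` for the valuation topology. -/
theorem density_property_of_henselian
    {K : Type*} {Γ₀ : Type*} [Field K] [LinearOrderedCommGroupWithZero Γ₀]
    [Valued K Γ₀] [CharZero K]
    [HenselianLocalRing ↥((Valued.v : Valuation K Γ₀).valuationSubring)]
    [CharZero (IsLocalRing.ResidueField ↥((Valued.v : Valuation K Γ₀).valuationSubring))]
    (hnontriv : ∃ x : K, Valued.v x ≠ 0 ∧ Valued.v x ≠ 1)
    {N : ℕ} (I : Ideal (MvPolynomial (Fin N) K)) (hprime : I.IsPrime)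
    (hsmooth : Algebra.Smooth K (MvPolynomial (Fin N) K ⧸ I))
    (f : MvPolynomial (Fin N) K) (hf : f ∉ I) :
    {x : Fin N → K | ∀ p ∈ I, MvPolynomial.eval x p = 0} ⊆
      closure {x : Fin N → K | (∀ p ∈ I, MvPolynomial.eval x p = 0) ∧
        MvPolynomial.eval x f ≠ 0} := by
  intro x₀ hx₀
  rw [mem_closure_iff_nhds]
  intro s hs
  let A := MvPolynomial (Fin N) K ⧸ I
  let ε : A →ₐ[K] K := Ideal.Quotient.liftₐ I (MvPolynomial.aeval x₀) (fun a ha => by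
    simpa [MvPolynomial.coe_aeval_eq_eval] using hx₀ a ha)
  let 𝔭 : Ideal A := RingHom.ker ε
  have : 𝔭.IsPrime := RingHom.ker_isPrime _
  have : Algebra.IsSmoothAt K 𝔭 := inferInstance
  obtain ⟨g, hg, n, _, _, hst⟩ :=
    Algebra.IsSmoothAt.exists_isStandardEtale_mvPolynomial (R := K) (S := A) (p := 𝔭)
  obtain ⟨P⟩ := hst.nonempty_standardEtalePresentation
  have hgu : IsUnit (ε g) := IsUnit.mk0 _ hg
  have hg0 : g ≠ 0 := by
    rintro rfl
    exact hg (Ideal.zero_mem _)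
  have hle : Submonoid.powers g ≤ nonZeroDivisors A := powers_le_nonZeroDivisors_of_noZeroDivisors hg0
  have : IsDomain (Localization.Away g) := IsLocalization.isDomain_localization hle
  let φ₀ : Localization.Away g →ₐ[K] K := IsLocalization.Away.liftAlgHom g (f := ε) hgu
  let ι : MvPolynomial (Fin N) K →ₐ[K] Localization.Away g :=
    (IsScalarTower.toAlgHom K A (Localization.Away g)).comp (Ideal.Quotient.mkₐ K I)
  have hι : ∀ p, ι p = algebraMap A (Localization.Away g) (Ideal.Quotient.mk I p) := fun p => rfl
  have hb : ι f ≠ 0 := by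
    rw [hι, ne_eq, IsLocalization.to_map_eq_zero_iff _ hle, Ideal.Quotient.eq_zero_iff_mem]
    exact hf
  have hφ₀ : (fun i => φ₀ (ι (X i))) = x₀ := by
    funext i
    have h : φ₀ (ι (X i)) = ε (Ideal.Quotient.mk I (X i)) := by
      simp [φ₀, hι]
    rw [h]
    exact MvPolynomial.aeval_X x₀ i
  obtain ⟨φ, hφ1, hφ2⟩ := density_chart hnontriv P φ₀ (ι f) hb (fun i => ι (X i)) s
    (by rwa [hφ₀])
  have hev : ∀ p, MvPolynomial.eval (fun i => φ (ι (X i))) p = φ (ι p) := by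
    intro p
    have : MvPolynomial.aeval (fun i => φ (ι (X i))) = φ.comp ι := by
      ext i
      simp
    have h := DFunLike.congr_fun this p
    simpa [MvPolynomial.coe_aeval_eq_eval] using h
  refine ⟨fun i => φ (ι (X i)), hφ1, fun p hp => ?_, ?_⟩
  · rw [hev, hι, Ideal.Quotient.eq_zero_iff_mem.2 hp, map_zero, map_zero]
  · rw [hev]
    exact hφ2
end
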